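/- Let z₁,…,zₙ be nonzero vectors in ℝ^m with all entries nonnegative, and let c = min_{1≤i,j≤n} ⟨z_i, z_j⟩/(‖z_i‖₂‖z_j‖₂) (note c ≥ 0). Then for any nonnegative coefficients λ₁,…,λₙ and μ₁,…,μₙ such that u = Σᵢ λᵢ zᵢ ≠ 0 and w = Σⱼ μⱼ zⱼ ≠ 0, it holds that ⟨u, w⟩/(‖u‖₂‖w‖₂) ≥ c. In particular, the maximum angle between pairs of nonzero conic combinations of z₁,…,zₙ is at most the maximum pairwise angle between the zᵢ. -/

import Mathlib

open Finset

noncomputable def euclNorm {d : ℕ} (x : Fin d → ℝ) : ℝ := Real.sqrt (∑ j, x j ^ 2)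

/-- A nonnegative lower bound on the pairwise cosines of a family of vectors passes to its conic
combinations. -/
theorem mul_norm_sum_smul_le_inner_sum_smul {E ι : Type*} [NormedAddCommGroup E]
    [InnerProductSpace ℝ E] [Fintype ι] {z : ι → E} {c : ℝ} (hc : 0 ≤ c)
    (h : ∀ i j, c * (‖z i‖ * ‖z j‖) ≤ inner ℝ (z i) (z j))
    {a b : ι → ℝ} (ha : ∀ i, 0 ≤ a i) (hb : ∀ i, 0 ≤ b i) :
    c * (‖∑ i, a i • z i‖ * ‖∑ i, b i • z i‖) ≤ inner ℝ (∑ i, a i • z i) (∑ i, b i • z i) := by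
  have norm_le : ∀ l : ι → ℝ, (∀ i, 0 ≤ l i) → ‖∑ i, l i • z i‖ ≤ ∑ i, l i * ‖z i‖ := by
    intro l hl
    refine norm_sum_le_of_le _ fun i _ => ?_
    rw [norm_smul, Real.norm_of_nonneg (hl i)]
  calc c * (‖∑ i, a i • z i‖ * ‖∑ i, b i • z i‖)
      ≤ c * ((∑ i, a i * ‖z i‖) * ∑ j, b j * ‖z j‖) := by
        gcongr
        · exact Finset.sum_nonneg fun i _ => mul_nonneg (ha i) (norm_nonneg _)
        · exact norm_le a ha
        · exact norm_le b hb
    _ = ∑ i, ∑ j, a i * b j * (c * (‖z i‖ * ‖z j‖)) := by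
        rw [Finset.sum_mul_sum, Finset.mul_sum]
        refine Finset.sum_congr rfl fun i _ => ?_
        rw [Finset.mul_sum]
        exact Finset.sum_congr rfl fun j _ => by ring
    _ ≤ ∑ i, ∑ j, a i * b j * inner ℝ (z i) (z j) :=
        Finset.sum_le_sum fun i _ => Finset.sum_le_sum fun j _ =>
          mul_le_mul_of_nonneg_left (h i j) (mul_nonneg (ha i) (hb j))
    _ = inner ℝ (∑ i, a i • z i) (∑ i, b i • z i) := by
        rw [sum_inner]
        refine Finset.sum_congr rfl fun i _ => ?_
        rw [inner_sum]
        refine Finset.sum_congr rfl fun j _ => ?_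
        rw [real_inner_smul_left, real_inner_smul_right, mul_assoc]

theorem euclNorm_eq_norm {d : ℕ} (x : Fin d → ℝ) : euclNorm x = ‖WithLp.toLp 2 x‖ := by
  simp [euclNorm, EuclideanSpace.norm_eq]

theorem sum_mul_eq_inner {d : ℕ} (x y : Fin d → ℝ) :
    ∑ t, x t * y t = inner ℝ (WithLp.toLp 2 x) (WithLp.toLp 2 y) := by
  simp [PiLp.inner_apply, mul_comm]

theorem euclNorm_pos {d : ℕ} {x : Fin d → ℝ} (hx : x ≠ 0) : 0 < euclNorm x := by
  rw [euclNorm_eq_norm, norm_pos_iff]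
  simpa using hx

theorem stmt6 {n m : ℕ} (hn : 0 < n) (z : Fin n → Fin m → ℝ)
    (hnz : ∀ i, z i ≠ 0) (hnonneg : ∀ i t, 0 ≤ z i t)
    (c : ℝ)
    (hc : IsLeast {r : ℝ | ∃ i j : Fin n,
      r = (∑ t, z i t * z j t) / (euclNorm (z i) * euclNorm (z j))} c)
    (lam mu : Fin n → ℝ) (hlam : ∀ i, 0 ≤ lam i) (hmu : ∀ i, 0 ≤ mu i)
    (u w : Fin m → ℝ) (hu : u = ∑ i, lam i • z i) (hw : w = ∑ i, mu i • z i)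
    (hu0 : u ≠ 0) (hw0 : w ≠ 0) :
    0 ≤ c ∧ c ≤ (∑ t, u t * w t) / (euclNorm u * euclNorm w) := by
  have hc0 : 0 ≤ c := by
    obtain ⟨i, j, hij⟩ := hc.1
    rw [hij]
    exact div_nonneg (Finset.sum_nonneg fun t _ => mul_nonneg (hnonneg i t) (hnonneg j t))
      (mul_nonneg (Real.sqrt_nonneg _) (Real.sqrt_nonneg _))
  refine ⟨hc0, ?_⟩
  have hz : ∀ i j, c * (‖WithLp.toLp 2 (z i)‖ * ‖WithLp.toLp 2 (z j)‖) ≤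
      inner ℝ (WithLp.toLp 2 (z i)) (WithLp.toLp 2 (z j)) := by
    intro i j
    have hij := hc.2 ⟨i, j, rfl⟩
    rwa [le_div_iff₀ (mul_pos (euclNorm_pos (hnz i)) (euclNorm_pos (hnz j))),
      euclNorm_eq_norm, euclNorm_eq_norm, sum_mul_eq_inner] at hij
  have key := mul_norm_sum_smul_le_inner_sum_smul hc0 hz hlam hmu
  rw [le_div_iff₀ (mul_pos (euclNorm_pos hu0) (euclNorm_pos hw0)),
    euclNorm_eq_norm, euclNorm_eq_norm, sum_mul_eq_inner, hu, hw]
  simpa only [WithLp.toLp_sum, WithLp.toLp_smul] using key
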